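/- arXiv:2109.00991 — 2 statements merged into one kernel-verified Lean document; each statement's English description precedes it below -/
import Mathlib

section
/- Let N = {a + ρ(a) : a ∈ A}. Then N is an ideal of the fixed subring A^ρ = {a ∈ A : ρ(a) = a}, and the quotient ring A^ρ/N is isomorphic to the polynomial ring 𝔽₂[z₁,…,zₙ] over the field with two elements, via an isomorphism sending z_i to the class of x_i·y_i. -/
open MvPolynomial

namespace MvPolynomial

variable {σ R : Type*} [CommRing R]

/-- The algebra homomorphism sending each variable `z_i` to `x_i * y_i`. -/
noncomputable def pairing (σ R : Type*) [CommRing R] :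
    MvPolynomial σ R →ₐ[R] MvPolynomial (σ ⊕ σ) R :=
  aeval fun i => X (Sum.inl i) * X (Sum.inr i)

theorem pairing_X (i : σ) : pairing σ R (X i) = X (Sum.inl i) * X (Sum.inr i) :=
  aeval_X _ i

theorem rename_swap_pairing (p : MvPolynomial σ R) :
    rename Sum.swap (pairing σ R p) = pairing σ R p := by
  have h : (rename Sum.swap).comp (pairing σ R) = pairing σ R := by
    ext1 i
    simp [pairing_X, mul_comm]
  exact DFunLike.congr_fun h p

theorem pairing_monomial (d : σ →₀ ℕ) (c : R) :
    pairing σ R (monomial d c) = monomial (d.sumElim d) c := by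
  have h : d.sumElim d = d.mapDomain Sum.inl + d.mapDomain Sum.inr := by
    ext (i | i)
    · simp [Finsupp.mapDomain_apply Sum.inl_injective, Finsupp.mapDomain_of_notMem_range]
    · simp [Finsupp.mapDomain_apply Sum.inr_injective, Finsupp.mapDomain_of_notMem_range]
  rw [h, ← mul_one c, ← monomial_mul, ← rename_monomial, ← rename_monomial, mul_one,
    pairing, aeval_monomial, monomial_eq, monomial_eq (a := (1 : R))]
  simp [Finsupp.prod, mul_pow, Finset.prod_mul_distrib, mul_assoc, algebraMap_eq,
    -prod_X_pow_eq_monomial]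

theorem coeff_sumElim_pairing (d : σ →₀ ℕ) (p : MvPolynomial σ R) :
    coeff (d.sumElim d) (pairing σ R p) = coeff d p := by
  classical
  induction p using MvPolynomial.induction_on' with
  | monomial e c =>
    rw [pairing_monomial, coeff_monomial, coeff_monomial]
    congr 1
    refine propext ⟨fun h => ?_, fun h => by rw [h]⟩
    ext i
    simpa using DFunLike.congr_fun h (Sum.inl i)
  | add p q hp hq => rw [map_add, coeff_add, coeff_add, hp, hq]

theorem mapDomain_swap_sumElim (d : σ →₀ ℕ) :
    (d.sumElim d).mapDomain Sum.swap = d.sumElim d := by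
  ext i
  rw [← Sum.swap_swap i, Finsupp.mapDomain_apply Sum.swap_leftInverse.injective]
  cases i <;> simp

theorem coeff_pairing_of_ne (d : σ ⊕ σ →₀ ℕ) (hd : d.mapDomain Sum.swap ≠ d)
    (p : MvPolynomial σ R) : coeff d (pairing σ R p) = 0 := by
  classical
  induction p using MvPolynomial.induction_on' with
  | monomial e c =>
    rw [pairing_monomial, coeff_monomial, if_neg]
    rintro rfl
    exact hd (mapDomain_swap_sumElim e)
  | add p q hp hq => rw [map_add, coeff_add, hp, hq, add_zero]

theorem mapDomain_swap_mapDomain_swap (d : σ ⊕ σ →₀ ℕ) :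
    (d.mapDomain Sum.swap).mapDomain Sum.swap = d := by
  rw [← Finsupp.mapDomain_comp, Sum.swap_swap_eq, Finsupp.mapDomain_id]

theorem coeff_rename_swap (d : σ ⊕ σ →₀ ℕ) (p : MvPolynomial (σ ⊕ σ) R) :
    coeff d (rename Sum.swap p) = coeff (d.mapDomain Sum.swap) p := by
  conv_lhs => rw [← mapDomain_swap_mapDomain_swap d]
  exact coeff_rename_mapDomain _ Sum.swap_leftInverse.injective _ _

theorem sumElim_of_mapDomain_swap_eq {d : σ ⊕ σ →₀ ℕ} (hd : d.mapDomain Sum.swap = d) :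
    ∃ e : σ →₀ ℕ, d = e.sumElim e := by
  refine ⟨d.comapDomain Sum.inl Sum.inl_injective.injOn, ?_⟩
  ext (i | i)
  · simp
  · have h := Finsupp.mapDomain_apply Sum.swap_leftInverse.injective d (Sum.inl i)
    rw [hd] at h
    simpa using h

/-- A swap-invariant polynomial is a polynomial in the `x_i * y_i` plus a trace. -/
theorem exists_eq_pairing_add_trace {b : MvPolynomial (σ ⊕ σ) R}
    (hb : rename Sum.swap b = b) :
    ∃ (q : MvPolynomial σ R) (a : MvPolynomial (σ ⊕ σ) R),
      b = pairing σ R q + (a + rename Sum.swap a) := by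
  classical
  let r : (σ ⊕ σ →₀ ℕ) → (σ ⊕ σ →₀ ℕ) → Prop := WellOrderingRel
  have hasymm {d e : σ ⊕ σ →₀ ℕ} (h : r d e) : ¬ r e d := asymm_of WellOrderingRel h
  have hne {d e : σ ⊕ σ →₀ ℕ} (h : r d e) : d ≠ e := ne_of_irrefl (r := WellOrderingRel) h
  have hinj : Function.Injective fun d : σ →₀ ℕ => d.sumElim d := fun d e h => by
    ext i
    simpa using DFunLike.congr_fun h (Sum.inl i)
  let q : MvPolynomial σ R := ∑ d ∈ b.support.preimage _ hinj.injOn,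
    monomial d (coeff (d.sumElim d) b)
  let a : MvPolynomial (σ ⊕ σ) R :=
    ∑ d ∈ b.support with r d (d.mapDomain Sum.swap), monomial d (coeff d b)
  have hq (d : σ →₀ ℕ) : coeff d q = coeff (d.sumElim d) b := by
    simp +contextual [q, coeff_sum, coeff_monomial, eq_comm]
  have ha (d : σ ⊕ σ →₀ ℕ) :
      coeff d a = if r d (d.mapDomain Sum.swap) then coeff d b else 0 := by
    simp only [a, coeff_sum, coeff_monomial, Finset.sum_ite_eq', Finset.mem_filter, mem_support_iff]
    grind
  refine ⟨q, a, ?_⟩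
  ext d
  have hbd : coeff (d.mapDomain Sum.swap) b = coeff d b := by
    rw [← coeff_rename_swap, hb]
  rw [coeff_add, coeff_add, coeff_rename_swap, ha, ha, mapDomain_swap_mapDomain_swap, hbd]
  rcases trichotomous_of WellOrderingRel d (d.mapDomain Sum.swap) with h | h | h
  · rw [coeff_pairing_of_ne d (hne h).symm, if_pos h, if_neg (hasymm h), zero_add, add_zero]
  · obtain ⟨e, he⟩ := sumElim_of_mapDomain_swap_eq h.symm
    have hd : ¬ r d (d.mapDomain Sum.swap) := fun hr => hne hr h
    have hd' : ¬ r (d.mapDomain Sum.swap) d := fun hr => hne hr h.symm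
    rw [if_neg hd, if_neg hd', add_zero, add_zero, he, coeff_sumElim_pairing, hq]
  · rw [coeff_pairing_of_ne d (hne h), if_neg (hasymm h), if_pos h, zero_add, zero_add]

theorem pairing_eq_trace_iff (p : MvPolynomial σ R) :
    (∃ a, pairing σ R p = a + rename Sum.swap a) ↔ C 2 ∣ p := by
  constructor
  · rintro ⟨a, ha⟩
    rw [C_dvd_iff_dvd_coeff]
    intro d
    rw [← coeff_sumElim_pairing, ha, coeff_add, coeff_rename_swap, mapDomain_swap_sumElim, ← two_mul]
    exact dvd_mul_right _ _
  · rintro ⟨q, rfl⟩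
    refine ⟨pairing σ R q, ?_⟩
    rw [rename_swap_pairing, map_mul, ← two_mul, map_ofNat, map_ofNat]

end MvPolynomial

theorem RingHom.exists_equiv_of_ker_eq {R S T : Type*} [CommRing R] [CommRing S] [CommRing T]
    {f : R →+* S} {g : R →+* T} (hf : Function.Surjective f) (hg : Function.Surjective g)
    (h : RingHom.ker f = RingHom.ker g) : ∃ e : S ≃+* T, ∀ r, e (f r) = g r := by
  refine ⟨(RingHom.quotientKerEquivOfSurjective hf).symm.trans
    ((Ideal.quotEquivOfEq h).trans (RingHom.quotientKerEquivOfSurjective hg)), fun r => ?_⟩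
  have hr : (RingHom.quotientKerEquivOfSurjective hf).symm (f r) = Ideal.Quotient.mk _ r := by
    rw [RingEquiv.symm_apply_eq]
    rfl
  rw [RingEquiv.trans_apply, hr]
  rfl

/-- Let `A = ℤ[x₁,y₁,…,xₙ,yₙ]` (realized as `MvPolynomial (Fin n ⊕ Fin n) ℤ`) and let `ρ`
be the ring involution interchanging each `x_i = X (Sum.inl i)` with `y_i = X (Sum.inr i)`
(i.e. `rename Sum.swap`).  Let `A^ρ` be the fixed subring and `N = {a + ρ(a) : a ∈ A}`.
Then `N` is an ideal of `A^ρ`, and the quotient `A^ρ/N` is isomorphic to the polynomial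
ring `𝔽₂[z₁,…,zₙ]`, via an isomorphism sending `z_i` to the class of `x_i·y_i`. -/
theorem tate_H0_of_swap_action (n : ℕ)
    (Afix : Subring (MvPolynomial (Fin n ⊕ Fin n) ℤ))
    (hAfix : ∀ a : MvPolynomial (Fin n ⊕ Fin n) ℤ,
      a ∈ Afix ↔ rename (Sum.swap : Fin n ⊕ Fin n → Fin n ⊕ Fin n) a = a) :
    ∃ N : Ideal Afix,
      (∀ x : Afix, x ∈ N ↔ ∃ a : MvPolynomial (Fin n ⊕ Fin n) ℤ,
        (x : MvPolynomial (Fin n ⊕ Fin n) ℤ) =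
          a + rename (Sum.swap : Fin n ⊕ Fin n → Fin n ⊕ Fin n) a) ∧
      ∃ e : MvPolynomial (Fin n) (ZMod 2) ≃+* (Afix ⧸ N),
        ∀ (i : Fin n) (x : Afix),
          (x : MvPolynomial (Fin n ⊕ Fin n) ℤ) = X (Sum.inl i) * X (Sum.inr i) →
          e (X i) = Ideal.Quotient.mk N x := by
  let N : Ideal Afix :=
    { carrier := {x | ∃ a : MvPolynomial (Fin n ⊕ Fin n) ℤ,
        (x : MvPolynomial (Fin n ⊕ Fin n) ℤ) = a + rename Sum.swap a}
      add_mem' := by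
        rintro x y ⟨a, ha⟩ ⟨b, hb⟩
        refine ⟨a + b, ?_⟩
        rw [Subring.coe_add, ha, hb, map_add]
        ring
      zero_mem' := ⟨0, by simp⟩
      smul_mem' := by
        rintro c x ⟨a, ha⟩
        refine ⟨c * a, ?_⟩
        rw [smul_eq_mul, Subring.coe_mul, ha, map_mul, (hAfix c).1 c.2, mul_add] }
  have hN (x : Afix) : x ∈ N ↔ ∃ a : MvPolynomial (Fin n ⊕ Fin n) ℤ,
      (x : MvPolynomial (Fin n ⊕ Fin n) ℤ) = a + rename Sum.swap a := Iff.rfl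
  let φ : MvPolynomial (Fin n) ℤ →+* Afix :=
    (pairing (Fin n) ℤ).toRingHom.codRestrict Afix fun p => (hAfix _).2 (rename_swap_pairing p)
  have hφ (p : MvPolynomial (Fin n) ℤ) : (φ p : MvPolynomial (Fin n ⊕ Fin n) ℤ) =
      pairing (Fin n) ℤ p := rfl
  have hsurj : Function.Surjective ((Ideal.Quotient.mk N).comp φ) := by
    intro y
    obtain ⟨x, rfl⟩ := Ideal.Quotient.mk_surjective y
    obtain ⟨q, a, h⟩ := exists_eq_pairing_add_trace ((hAfix x).1 x.2)
    refine ⟨q, ((Ideal.Quotient.mk_eq_mk_iff_sub_mem _ _).2 ((hN _).2 ⟨a, ?_⟩)).symm⟩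
    rw [AddSubgroupClass.coe_sub, hφ, h, add_sub_cancel_left]
  have hker : RingHom.ker (map (σ := Fin n) (Int.castRingHom (ZMod 2))) =
      RingHom.ker ((Ideal.Quotient.mk N).comp φ) := by
    ext p
    rw [RingHom.mem_ker, RingHom.mem_ker, RingHom.comp_apply, Ideal.Quotient.eq_zero_iff_mem, hN,
      hφ, pairing_eq_trace_iff]
    exact (C_dvd_iff_zmod 2 p).symm
  obtain ⟨e, he⟩ := RingHom.exists_equiv_of_ker_eq
    (map_surjective _ (ZMod.ringHom_surjective _)) hsurj hker
  refine ⟨N, hN, e, fun i x hx => ?_⟩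
  have hX : φ (X i) = x := Subtype.ext (by rw [hφ, pairing_X, hx])
  rw [← map_X (Int.castRingHom (ZMod 2)), he, RingHom.comp_apply, hX]
end

section
/- For all p, q, r ∈ A, setting f = 2x + x²·p and g = 3y + y·(x·q + y·r), the product x·y lies in the ideal of A generated by f and g. -/
open MvPowerSeries

/-- Let `A = R[[x,y]]` (realized as `MvPowerSeries (Fin 2) R` with `x = X 0`, `y = X 1`).
For all `p, q, r ∈ A`, setting `f = 2x + x²·p` and `g = 3y + y·(x·q + y·r)`, the product
`x·y` lies in the ideal of `A` generated by `f` and `g`. -/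
theorem xy_mem_span_of_deformed_relations {R : Type*} [CommRing R]
    (p q r : MvPowerSeries (Fin 2) R) :
    (X 0 * X 1 : MvPowerSeries (Fin 2) R) ∈
      Ideal.span {(2 * X 0 + (X 0) ^ 2 * p : MvPowerSeries (Fin 2) R),
        3 * X 1 + X 1 * (X 0 * q + X 1 * r)} := by
  have hu : IsUnit (1 + X 0 * (q - p) + X 1 * r : MvPowerSeries (Fin 2) R) := by
    simp [MvPowerSeries.isUnit_iff_constantCoeff]
  rw [← Ideal.mul_unit_mem_iff_mem _ hu, Ideal.mem_span_pair]
  exact ⟨-X 1, X 0, by ring⟩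
end
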